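/- For every integer k ≥ 3 there exists a constant C = C(k) such that for every convex body K ⊆ ℝ² of unit area, n^{-2} · EH^K_{2,k}(n) converges to C as n → ∞; in particular, the limit exists and does not depend on K. -/

import Mathlib

open MeasureTheory Filter

noncomputable section

abbrev Euc (d : ℕ) : Type := EuclideanSpace ℝ (Fin d)

/-- A convex body: compact convex set with nonempty interior. -/
def IsConvexBody {d : ℕ} (K : Set (Euc d)) : Prop :=
  Convex ℝ K ∧ IsCompact K ∧ (interior K).Nonempty

/-- A set of points is in convex position if no point lies in the convex
hull of the others. -/
def InConvexPosition {d : ℕ} (P : Set (Euc d)) : Prop :=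
  ∀ p ∈ P, p ∉ convexHull ℝ (P \ {p})

/-- `H` is a `k`-hole in `S`. -/
def IsHole {d : ℕ} (k : ℕ) (S H : Finset (Euc d)) : Prop :=
  H ⊆ S ∧ H.card = k ∧ InConvexPosition (H : Set (Euc d)) ∧
    ∀ p ∈ S, p ∉ interior (convexHull ℝ (H : Set (Euc d)))

open Classical in
/-- The number of `k`-holes in the point set given by `x`. -/
noncomputable def holeCount (d k n : ℕ) (x : Fin n → Euc d) : ℕ :=
  ((Finset.image x Finset.univ).powerset.filter
    (fun H => IsHole k (Finset.image x Finset.univ) H)).card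

/-- The uniform probability distribution on `K`. -/
noncomputable def unif {d : ℕ} (K : Set (Euc d)) : Measure (Euc d) :=
  (volume K)⁻¹ • volume.restrict K

/-- The expected number of `k`-holes among `n` points drawn uniformly and
independently at random from `K`. -/
noncomputable def EH (d k : ℕ) (K : Set (Euc d)) (n : ℕ) : ℝ :=
  ∫ x : Fin n → Euc d, (holeCount d k n x : ℝ) ∂(Measure.pi fun _ : Fin n => unif K)

/-- The probability that, for `d+2` points chosen uniformly and independently
at random from `K`, one of the points lies in the convex hull of the others. -/
noncomputable def pSimplex (d : ℕ) (K : Set (Euc d)) : ℝ :=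
  ((Measure.pi fun _ : Fin (d + 2) => unif K)
    {x : Fin (d + 2) → Euc d | ∃ i, x i ∈ convexHull ℝ (x '' {j | j ≠ i})}).toReal

/-- The maximum of `pSimplex d K` over all convex bodies `K ⊆ ℝ^d`. -/
noncomputable def pMax (d : ℕ) : ℝ :=
  sSup {p : ℝ | ∃ K : Set (Euc d), IsConvexBody K ∧ p = pSimplex d K}

end

/-- The interior of the convex hull of a family of points. -/
def hullInterior {ι : Type*} (y : ι → Euc 2) : Set (Euc 2) :=
  interior (convexHull ℝ (Set.range y))

/-- The points `y i` have increasing first coordinates, are in convex position, and lie outside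
the interior of their convex hull. -/
def IsOrderedConvex {k : ℕ} (y : Fin k → Euc 2) : Prop :=
  StrictMono (fun i => y i 0) ∧ (∀ i, y i ∉ convexHull ℝ (y '' {i}ᶜ)) ∧
    ∀ i, y i ∉ hullInterior y

theorem isClosed_setOf_mem_convexHull_range (ι : Type*) [Finite ι] :
    IsClosed {p : (ι → Euc 2) × Euc 2 | p.2 ∈ convexHull ℝ (Set.range p.1)} := by
  cases nonempty_fintype ι
  have : CompactSpace (stdSimplex ℝ ι) := isCompact_iff_compactSpace.1 (isCompact_stdSimplex ℝ ι)
  have hcl : IsClosed {q : stdSimplex ℝ ι × ((ι → Euc 2) × Euc 2) |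
      ∑ i, (q.1 : ι → ℝ) i • q.2.1 i = q.2.2} := by
    apply isClosed_eq
    · refine continuous_finsetSum _ fun i _ => ?_
      exact ((continuous_apply i).comp (continuous_subtype_val.comp continuous_fst)).smul
        ((continuous_apply i).comp (continuous_fst.comp continuous_snd))
    · fun_prop
  convert isClosedMap_snd_of_compactSpace _ hcl using 1
  ext p
  have hh : convexHull ℝ (Set.range p.1) =
      (Fintype.linearCombination ℝ p.1) '' stdSimplex ℝ ι := by
    classical
    rw [← convexHull_basis_eq_stdSimplex, LinearMap.image_convexHull, ← Set.range_comp]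
    congr 2
    ext i : 1
    simp [Fintype.linearCombination_apply]
  simp only [Set.mem_ofPred_eq, hh, Set.mem_image, Fintype.linearCombination_apply]
  constructor
  · rintro ⟨w, hw, h⟩
    exact ⟨(⟨w, hw⟩, p), h, rfl⟩
  · rintro ⟨⟨w, q⟩, h, rfl⟩
    exact ⟨w, w.2, h⟩

theorem measurableSet_setOf_mem_hullInterior (ι : Type*) [Finite ι] :
    MeasurableSet {p : (ι → Euc 2) × Euc 2 | p.2 ∈ hullInterior p.1} := by
  have : {p : (ι → Euc 2) × Euc 2 | p.2 ∈ hullInterior p.1} =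
      ⋃ n : ℕ, ⋂ v ∈ Metric.ball (0 : Euc 2) (1 / (n + 1 : ℝ)),
        (fun p : (ι → Euc 2) × Euc 2 => (p.1, p.2 + v)) ⁻¹'
          {p | p.2 ∈ convexHull ℝ (Set.range p.1)} := by
    ext p
    simp only [hullInterior, Set.mem_ofPred_eq, Set.mem_iUnion, Set.mem_iInter, Set.mem_preimage]
    rw [mem_interior_iff_mem_nhds, Metric.mem_nhds_iff]
    constructor
    · rintro ⟨r, hr, h⟩
      obtain ⟨n, hn⟩ := exists_nat_one_div_lt hr
      refine ⟨n, fun v hv => h ?_⟩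
      rw [mem_ball_zero_iff] at hv
      simpa using hv.trans hn
    · rintro ⟨n, h⟩
      refine ⟨1 / (n + 1 : ℝ), by positivity, fun z hz => ?_⟩
      have := h (z - p.2) (by simpa [dist_eq_norm] using hz)
      simpa using this
  rw [this]
  refine MeasurableSet.iUnion fun n => IsClosed.measurableSet ?_
  exact isClosed_biInter fun v _ =>
    (isClosed_setOf_mem_convexHull_range ι).preimage (by fun_prop)

theorem measurableSet_isOrderedConvex (k : ℕ) :
    MeasurableSet {y : Fin k → Euc 2 | IsOrderedConvex y} := by
  simp only [IsOrderedConvex, StrictMono, Set.ofPred_and, Set.ofPred_forall]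
  refine MeasurableSet.inter ?_ (MeasurableSet.inter ?_ ?_)
  · refine MeasurableSet.iInter fun i => MeasurableSet.iInter fun j => MeasurableSet.iInter fun _ => ?_
    exact measurableSet_lt (by fun_prop) (by fun_prop)
  · refine MeasurableSet.iInter fun i => MeasurableSet.compl ?_
    have h : Continuous fun y : Fin k → Euc 2 =>
        ((fun j : ({i}ᶜ : Set (Fin k)) => y j, y i) : (({i}ᶜ : Set (Fin k)) → Euc 2) × Euc 2) := by
      fun_prop
    simp only [Set.image_eq_range]
    exact ((isClosed_setOf_mem_convexHull_range ({i}ᶜ : Set (Fin k))).preimage h).measurableSet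
  · refine MeasurableSet.iInter fun i => MeasurableSet.compl ?_
    have h : Measurable fun y : Fin k → Euc 2 => (y, y i) := by fun_prop
    exact h (measurableSet_setOf_mem_hullInterior (Fin k))

/-- The event that the points of `x` selected by `f` form a hole, listed from left to right. -/
def holeEvent {k n : ℕ} (f : Fin k ↪ Fin n) : Set (Fin n → Euc 2) :=
  {x | IsOrderedConvex (x ∘ f) ∧ ∀ j ∉ Set.range f, x j ∉ hullInterior (x ∘ f)}

theorem inConvexPosition_range_iff {ι : Type*} {y : ι → Euc 2} (hy : Function.Injective y) :
    InConvexPosition (Set.range y) ↔ ∀ i, y i ∉ convexHull ℝ (y '' {i}ᶜ) := by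
  have h : ∀ i, Set.range y \ {y i} = y '' {i}ᶜ := fun i => by
    rw [Set.image_compl_eq_range_sdiff_image hy, Set.image_singleton]
  simp [InConvexPosition, h]

theorem isHole_image_iff {k n : ℕ} {x : Fin n → Euc 2} {f : Fin k ↪ Fin n}
    (hf : StrictMono fun i => x (f i) 0) [DecidableEq (Euc 2)] :
    IsHole k (Finset.image x Finset.univ) (Finset.image (x ∘ f) Finset.univ) ↔
      x ∈ holeEvent f := by
  have hinj : Function.Injective (x ∘ f) := fun i j h => hf.injective (congrArg (fun p => p 0) h)
  have hcard : (Finset.image (x ∘ f) Finset.univ).card = k := by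
    rw [Finset.card_image_of_injective _ hinj, Finset.card_univ, Fintype.card_fin]
  have hsub : Finset.image (x ∘ f) Finset.univ ⊆ Finset.image x Finset.univ := by
    intro p
    simp only [Finset.mem_image, Finset.mem_univ, true_and]
    rintro ⟨i, rfl⟩
    exact ⟨f i, rfl⟩
  simp only [IsHole, hcard, hsub, true_and, Finset.coe_image, Finset.coe_univ, Set.image_univ,
    inConvexPosition_range_iff hinj, holeEvent, IsOrderedConvex, Set.mem_ofPred_eq,
    Finset.mem_image, Finset.mem_univ, forall_exists_index, forall_apply_eq_imp_iff]
  constructor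
  · rintro ⟨h₁, h₂⟩
    exact ⟨⟨hf, h₁, fun i => h₂ (f i)⟩, fun j _ => h₂ j⟩
  · rintro ⟨⟨-, h₁, h₂⟩, h₃⟩
    refine ⟨h₁, fun j => ?_⟩
    by_cases hj : j ∈ Set.range f
    · obtain ⟨i, rfl⟩ := hj
      exact h₂ i
    · exact h₃ j hj

open Classical in
theorem holeCount_eq_card {k n : ℕ} {x : Fin n → Euc 2}
    (hx : Function.Injective fun i => x i 0) :
    holeCount 2 k n x = (Finset.univ.filter fun f : Fin k ↪ Fin n => x ∈ holeEvent f).card := by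
  have hxi : Function.Injective x := fun i j h => hx (congrArg (fun p => p 0) h)
  rw [holeCount, eq_comm]
  apply Finset.card_bij (fun (f : Fin k ↪ Fin n) _ => Finset.image (x ∘ f) Finset.univ)
  · intro f hf
    rw [Finset.mem_filter] at hf
    have := (isHole_image_iff hf.2.1.1).2 hf.2
    exact Finset.mem_filter.2 ⟨Finset.mem_powerset.2 this.1, this⟩
  · intro f hf g hg hfg
    rw [Finset.mem_filter] at hf hg
    have hr : (Set.range fun i => x (f i)) = Set.range fun i => x (g i) := by
      simpa using congrArg (fun s : Finset (Euc 2) => (s : Set (Euc 2))) hfg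
    have hr' : Set.range (fun i => x (f i) 0) = Set.range (fun i => x (g i) 0) := by
      have := congrArg (fun s => (fun p : Euc 2 => p 0) '' s) hr
      simp only [← Set.range_comp] at this
      exact this
    have := (hf.2.1.1.range_inj hg.2.1.1).1 hr'
    ext i : 1
    exact hx (congrFun this i)
  · intro H hH
    rw [Finset.mem_filter] at hH
    obtain ⟨-, hH⟩ := hH
    let s : Finset (Fin n) := Finset.univ.filter fun i => x i ∈ H
    have hs : s.image x = H := by
      ext p
      constructor
      · intro hp
        obtain ⟨i, hi, rfl⟩ := Finset.mem_image.1 hp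
        exact (Finset.mem_filter.1 hi).2
      · intro hp
        obtain ⟨i, -, rfl⟩ := Finset.mem_image.1 (hH.1 hp)
        exact Finset.mem_image.2 ⟨i, Finset.mem_filter.2 ⟨Finset.mem_univ i, hp⟩, rfl⟩
    let t : Finset ℝ := s.image fun i => x i 0
    have ht : t.card = k := by
      rw [Finset.card_image_of_injective _ hx, ← hH.2.1, ← hs, Finset.card_image_of_injective _ hxi]
    have hmem : ∀ i : Fin k, ∃ j ∈ s, x j 0 = t.orderEmbOfFin ht i := fun i =>
      Finset.mem_image.1 (t.orderEmbOfFin_mem ht i)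
    choose g hgs hg using hmem
    have hmono : StrictMono fun i => x (g i) 0 := by
      simpa only [hg] using (t.orderEmbOfFin ht).strictMono
    let f : Fin k ↪ Fin n := ⟨g, fun i j h => hmono.injective (congrArg (fun l => x l 0) h)⟩
    have himg : Finset.image (x ∘ f) Finset.univ = H := by
      apply Finset.eq_of_subset_of_card_le
      · intro p hp
        obtain ⟨i, -, rfl⟩ := Finset.mem_image.1 hp
        exact (Finset.mem_filter.1 (hgs i)).2
      · rw [hH.2.1, Finset.card_image_of_injective _ (hxi.comp f.injective), Finset.card_univ,
          Fintype.card_fin]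
    refine ⟨f, Finset.mem_filter.2 ⟨Finset.mem_univ f, ?_⟩, himg⟩
    rw [← isHole_image_iff (f := f) hmono, himg]
    exact hH

theorem measurableSet_holeEvent {k n : ℕ} (f : Fin k ↪ Fin n) : MeasurableSet (holeEvent f) := by
  have hc : Measurable fun x : Fin n → Euc 2 => x ∘ f :=
    measurable_pi_lambda _ fun i => measurable_pi_apply (f i)
  simp only [holeEvent, Set.ofPred_and, Set.ofPred_forall]
  refine (hc (measurableSet_isOrderedConvex k)).inter ?_
  refine MeasurableSet.iInter fun j => MeasurableSet.iInter fun _ => MeasurableSet.compl ?_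
  exact (hc.prodMk (measurable_pi_apply j)) (measurableSet_setOf_mem_hullInterior (Fin k))

theorem measure_pi_holeEvent {k n : ℕ} (f : Fin k ↪ Fin n) (μ : Measure (Euc 2))
    [IsProbabilityMeasure μ] :
    (Measure.pi fun _ : Fin n => μ) (holeEvent f) =
      ∫⁻ y, {y | IsOrderedConvex y}.indicator (fun y => μ (hullInterior y)ᶜ ^ (n - k)) y
        ∂(Measure.pi fun _ : Fin k => μ) := by
  classical
  let e : Fin k ⊕ ((Set.range f)ᶜ : Set (Fin n)) ≃ Fin n :=
    ((Equiv.ofInjective f f.injective).sumCongr (Equiv.refl _)).trans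
      (Equiv.Set.sumCompl (Set.range f))
  have hmp := (measurePreserving_piCongrLeft (fun _ : Fin n => μ) e).comp
    (measurePreserving_sumPiEquivProdPi_symm
      (fun _ : Fin k ⊕ ((Set.range f)ᶜ : Set (Fin n)) => μ))
  rw [← hmp.measure_preimage (measurableSet_holeEvent f).nullMeasurableSet,
    Measure.prod_apply (hmp.measurable (measurableSet_holeEvent f))]
  refine lintegral_congr fun y => ?_
  have hl : ∀ (z : ((Set.range f)ᶜ : Set (Fin n)) → Euc 2) (i : Fin k),
      MeasurableEquiv.piCongrLeft (fun _ : Fin n => Euc 2) e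
        ((MeasurableEquiv.sumPiEquivProdPi fun _ => Euc 2).symm (y, z)) (f i) = y i := fun z i =>
    Equiv.piCongrLeft_apply_apply (fun _ : Fin n => Euc 2) e _ (Sum.inl i)
  have hr : ∀ (z : ((Set.range f)ᶜ : Set (Fin n)) → Euc 2) (j : ((Set.range f)ᶜ : Set (Fin n))),
      MeasurableEquiv.piCongrLeft (fun _ : Fin n => Euc 2) e
        ((MeasurableEquiv.sumPiEquivProdPi fun _ => Euc 2).symm (y, z)) j = z j := fun z j =>
    Equiv.piCongrLeft_apply_apply (fun _ : Fin n => Euc 2) e _ (Sum.inr j)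
  have hcard : Fintype.card ((Set.range f)ᶜ : Set (Fin n)) = n - k := by
    rw [Fintype.card_compl_set, Fintype.card_fin, Set.card_range_of_injective f.injective,
      Fintype.card_fin]
  have hset : Prod.mk y ⁻¹' ((MeasurableEquiv.piCongrLeft (fun _ : Fin n => Euc 2) e ∘
      (MeasurableEquiv.sumPiEquivProdPi fun _ => Euc 2).symm) ⁻¹' holeEvent f) =
      {z | IsOrderedConvex y ∧ z ∈ Set.univ.pi fun _ => (hullInterior y)ᶜ} := by
    ext z
    have hy : MeasurableEquiv.piCongrLeft (fun _ : Fin n => Euc 2) e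
        ((MeasurableEquiv.sumPiEquivProdPi fun _ => Euc 2).symm (y, z)) ∘ f = y := funext (hl z)
    simp only [Set.mem_preimage, Function.comp_apply, holeEvent, Set.mem_ofPred_eq, hy,
      Set.mem_pi, Set.mem_univ, true_imp_iff, Set.mem_compl_iff]
    refine and_congr_right fun _ => ⟨fun h j => ?_, fun h j hj => ?_⟩
    · rw [← hr z j]
      exact h j j.2
    · rw [hr z ⟨j, hj⟩]
      exact h _
  rw [hset]
  by_cases hy : IsOrderedConvex y
  · rw [Set.indicator_of_mem (by exact hy)]
    simp [hy, Measure.pi_pi, hcard, -Set.mem_pi]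
  · rw [Set.indicator_of_notMem (by exact hy)]
    simp [hy]

theorem ae_injective_fst_coord (n : ℕ) (K : Set (Euc 2)) :
    ∀ᵐ x ∂(Measure.pi fun _ : Fin n => (volume : Measure (Euc 2)).restrict K),
      Function.Injective fun i => x i 0 := by
  rw [← Measure.restrict_pi_pi (fun _ : Fin n => (volume : Measure (Euc 2))) fun _ => K]
  apply ae_restrict_of_ae
  have h : ∀ i j : Fin n, i ≠ j → ∀ᵐ x : Fin n → Euc 2, x i 0 ≠ x j 0 := by
    intro i j hij
    let φ : (Fin n → Euc 2) →ₗ[ℝ] ℝ :=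
      { toFun := fun x => x i 0 - x j 0
        map_add' := fun x y => by simp; ring
        map_smul' := fun c x => by simp; ring }
    have hφ : LinearMap.ker φ ≠ ⊤ := by
      intro h
      have h1 : Pi.single i (EuclideanSpace.single 0 1) ∈ LinearMap.ker φ := h ▸ Submodule.mem_top
      rw [LinearMap.mem_ker] at h1
      simp [φ, hij.symm] at h1
    have := Measure.addHaar_submodule volume (LinearMap.ker φ) hφ
    refine measure_mono_null (fun x hx => ?_) this
    simp only [Set.mem_compl_iff, Set.mem_ofPred_eq, not_not] at hx
    simp [φ, hx]
  have h' : ∀ᵐ x : Fin n → Euc 2, ∀ i j : Fin n, i ≠ j → x i 0 ≠ x j 0 := by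
    simp only [ae_all_iff]
    exact h
  filter_upwards [h'] with x hx i j hij
  by_contra hne
  exact hx i j hne hij

theorem EH_eq {k n : ℕ} {K : Set (Euc 2)} (hK : volume K = 1) :
    EH 2 k K n = n.descFactorial k *
      (∫⁻ y, {y | IsOrderedConvex y}.indicator
        (fun y => (volume.restrict K) (hullInterior y)ᶜ ^ (n - k)) y
          ∂(Measure.pi fun _ : Fin k => (volume : Measure (Euc 2)).restrict K)).toReal := by
  classical
  have hu : unif K = volume.restrict K := by simp [unif, hK]
  have : IsProbabilityMeasure (volume.restrict K) := ⟨by simpa using hK⟩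
  have hae : (fun x : Fin n → Euc 2 => (holeCount 2 k n x : ℝ)) =ᵐ[Measure.pi fun _ : Fin n =>
      (volume : Measure (Euc 2)).restrict K]
      fun x => ∑ f : Fin k ↪ Fin n, (holeEvent f).indicator (fun _ => (1 : ℝ)) x := by
    filter_upwards [ae_injective_fst_coord n K] with x hx
    rw [holeCount_eq_card hx, Finset.card_filter]
    push_cast
    exact Finset.sum_congr rfl fun f _ => by simp [Set.indicator_apply]
  rw [EH, hu, integral_congr_ae hae, integral_finsetSum]
  · simp only [integral_indicator_const _ (measurableSet_holeEvent _), Measure.real,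
      measure_pi_holeEvent]
    simp [Fintype.card_embedding_eq]
  · intro f _
    exact (integrable_const _).indicator (measurableSet_holeEvent f)

theorem hullInterior_affine {ι : Type*} (L : Euc 2 ≃ₗ[ℝ] Euc 2) (a : Euc 2) (y : ι → Euc 2) :
    hullInterior (fun i => a + L (y i)) = (fun p => a + L p) '' hullInterior y := by
  let h : Euc 2 ≃ₜ Euc 2 :=
    L.toContinuousLinearEquiv.toHomeomorph.trans (Homeomorph.addLeft a)
  let T : Euc 2 →ᵃ[ℝ] Euc 2 := AffineMap.const ℝ (Euc 2) a + (L : Euc 2 →ₗ[ℝ] Euc 2).toAffineMap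
  have hT : ⇑T = fun p => a + L p := rfl
  have hh : ⇑h = fun p => a + L p := rfl
  rw [hullInterior, hullInterior, ← hh, h.image_interior, hh, ← hT, T.image_convexHull,
    ← Set.range_comp]
  rfl

theorem volume_image_affine (L : Euc 2 ≃ₗ[ℝ] Euc 2) (a : Euc 2) (s : Set (Euc 2)) :
    volume ((fun p => a + L p) '' s) =
      ENNReal.ofReal |LinearMap.det (L : Euc 2 →ₗ[ℝ] Euc 2)| * volume s := by
  have : (fun p => a + L p) '' s = (a + ·) '' ((L : Euc 2 →ₗ[ℝ] Euc 2) '' s) := by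
    rw [Set.image_image]; rfl
  rw [this, Set.image_add_left, measure_preimage_add, Measure.addHaar_image_linearMap]

theorem isOrderedConvex_affine_iff {k : ℕ} (L : Euc 2 ≃ₗ[ℝ] Euc 2) (a : Euc 2) {c : ℝ}
    (hc : 0 < c) (hL : ∀ p, L p 0 = c * p 0) (y : Fin k → Euc 2) :
    IsOrderedConvex (fun i => a + L (y i)) ↔ IsOrderedConvex y := by
  have hinj : Function.Injective fun p => a + L p := fun p q h => L.injective (add_left_cancel h)
  let T : Euc 2 →ᵃ[ℝ] Euc 2 := AffineMap.const ℝ (Euc 2) a + (L : Euc 2 →ₗ[ℝ] Euc 2).toAffineMap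
  have hT : ⇑T = fun p => a + L p := rfl
  have hhull : ∀ i : Fin k, convexHull ℝ ((fun i => a + L (y i)) '' {i}ᶜ) =
      (fun p => a + L p) '' convexHull ℝ (y '' {i}ᶜ) := fun i => by
    rw [← hT, T.image_convexHull, Set.image_image, hT]
  simp only [IsOrderedConvex, hullInterior_affine, hhull]
  refine and_congr ?_ (and_congr ?_ ?_)
  · simp [StrictMono, hL, hc]
  · exact forall_congr' fun i => not_congr (hinj.mem_set_image (a := y i))
  · exact forall_congr' fun i => not_congr (hinj.mem_set_image (a := y i))

theorem lintegral_pi_affine (m : ℕ) (L : Euc 2 ≃ₗ[ℝ] Euc 2) (a : Euc 2)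
    {g : (Fin m → Euc 2) → ENNReal} (hg : Measurable g) :
    ∫⁻ w : Fin m → Euc 2, g (fun i => a + L (w i)) =
      ENNReal.ofReal |(LinearMap.det (L : Euc 2 →ₗ[ℝ] Euc 2))⁻¹| ^ m * ∫⁻ z, g z := by
  set c := ENNReal.ofReal |(LinearMap.det (L : Euc 2 →ₗ[ℝ] Euc 2))⁻¹| with hc
  have hTm : Measurable fun p : Euc 2 => a + L p :=
    (continuous_const.add L.toContinuousLinearEquiv.continuous).measurable
  have hmap : MeasurePreserving (fun p : Euc 2 => a + L p) volume (c • volume) := by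
    refine ⟨hTm, ?_⟩
    have hdet : LinearMap.det (L : Euc 2 →ₗ[ℝ] Euc 2) ≠ 0 := (LinearEquiv.isUnit_det' L).ne_zero
    have hLm : Measurable (L : Euc 2 →ₗ[ℝ] Euc 2) := L.toContinuousLinearEquiv.continuous.measurable
    have : (fun p : Euc 2 => a + L p) = (a + ·) ∘ (L : Euc 2 →ₗ[ℝ] Euc 2) := rfl
    rw [this, ← Measure.map_map (measurable_const_add a) hLm,
      Measure.map_linearMap_addHaar_eq_smul_addHaar _ hdet, Measure.map_smul,
      map_add_left_eq_self]
  have : SigmaFinite (c • (volume : Measure (Euc 2))) := by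
    exact SMul.sigmaFinite (μ := (volume : Measure (Euc 2)))
      (|(LinearMap.det (L : Euc 2 →ₗ[ℝ] Euc 2))⁻¹|).toNNReal
  have hpi : (Measure.pi fun _ : Fin m => c • (volume : Measure (Euc 2))) = c ^ m • volume := by
    refine Measure.pi_eq fun s _ => ?_
    simp [Finset.prod_mul_distrib, volume_pi, Measure.pi_pi]
  have hmp := measurePreserving_pi (fun _ : Fin m => (volume : Measure (Euc 2)))
    (fun _ => c • (volume : Measure (Euc 2))) (fun _ => hmap)
  have := hmp.lintegral_comp hg
  rw [hpi, lintegral_smul_measure, smul_eq_mul] at this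
  exact this

/-- The linear map sending the first basis vector to `v` and preserving vertical lines, with
determinant `s`. -/
noncomputable def shearMap (v : Euc 2) (s : ℝ) : Euc 2 →ₗ[ℝ] Euc 2 where
  toFun p := !₂[v 0 * p 0, v 1 * p 0 + s / v 0 * p 1]
  map_add' p q := by ext i; fin_cases i <;> simp <;> ring
  map_smul' c p := by ext i; fin_cases i <;> simp <;> ring

theorem det_shearMap {v : Euc 2} (hv : v 0 ≠ 0) (s : ℝ) : LinearMap.det (shearMap v s) = s := by
  rw [← LinearMap.det_toMatrix (EuclideanSpace.basisFun (Fin 2) ℝ).toBasis, Matrix.det_fin_two]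
  simp [LinearMap.toMatrix_apply, shearMap]
  field_simp

/-- `shearMap` as a linear equivalence. -/
noncomputable def shearEquiv (v : Euc 2) (s : ℝ) (hv : v 0 ≠ 0) (hs : s ≠ 0) :
    Euc 2 ≃ₗ[ℝ] Euc 2 :=
  LinearMap.equivOfDetNeZero (shearMap v s) (by rwa [det_shearMap hv])

theorem coe_shearEquiv {v : Euc 2} {s : ℝ} (hv : v 0 ≠ 0) (hs : s ≠ 0) :
    (shearEquiv v s hv hs : Euc 2 →ₗ[ℝ] Euc 2) = shearMap v s := rfl

theorem shearEquiv_apply {v : Euc 2} {s : ℝ} (hv : v 0 ≠ 0) (hs : s ≠ 0) (p : Euc 2) :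
    shearEquiv v s hv hs p = !₂[v 0 * p 0, v 1 * p 0 + s / v 0 * p 1] := rfl

/-- The standard basis vector `(1, 0)`. -/
noncomputable def unitX : Euc 2 := !₂[1, 0]

theorem shearEquiv_unitX {v : Euc 2} {s : ℝ} (hv : v 0 ≠ 0) (hs : s ≠ 0) :
    shearEquiv v s hv hs unitX = v := by
  rw [shearEquiv_apply]
  ext i
  fin_cases i <;> simp [unitX]

/-- The tuple starting at `a`, ending at `b`, with the points of `z` in between. -/
def config {m : ℕ} (a b : Euc 2) (z : Fin m → Euc 2) : Fin (m + 2) → Euc 2 :=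
  (0 : Fin (m + 2)).insertNth (α := fun _ => Euc 2) a
    ((Fin.last m).insertNth (α := fun _ => Euc 2) b z)

section config

variable {m : ℕ} (a b : Euc 2) (z : Fin m → Euc 2)

theorem config_zero : config a b z 0 = a := by
  simp [config]

theorem config_last : config a b z ((0 : Fin (m + 2)).succAbove (Fin.last m)) = b := by
  simp only [config, Fin.insertNth_apply_succAbove, Fin.insertNth_apply_same]

theorem config_mid (i : Fin m) :
    config a b z ((0 : Fin (m + 2)).succAbove ((Fin.last m).succAbove i)) = z i := by
  simp only [config, Fin.insertNth_apply_succAbove]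

theorem forall_config (P : Fin (m + 2) → Prop) : (∀ i, P i) ↔
    P 0 ∧ P ((0 : Fin (m + 2)).succAbove (Fin.last m)) ∧
      ∀ i : Fin m, P ((0 : Fin (m + 2)).succAbove ((Fin.last m).succAbove i)) := by
  rw [Fin.forall_iff_succAbove 0, Fin.forall_iff_succAbove (Fin.last m)]

theorem comp_config (T : Euc 2 → Euc 2) :
    config (T a) (T b) (fun i => T (z i)) = fun i => T (config a b z i) := by
  apply funext
  rw [forall_config]
  simp only [config_zero, config_last, config_mid, implies_true, and_self]

theorem IsOrderedConvex.config_lt {a b : Euc 2} {z : Fin m → Euc 2}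
    (h : IsOrderedConvex (config a b z)) : a 0 < b 0 := by
  have := h.1 (show (0 : Fin (m + 2)) < (0 : Fin (m + 2)).succAbove (Fin.last m) by simp [Fin.lt_def])
  simpa only [config_zero, config_last] using this

theorem IsOrderedConvex.config_mem_Icc {a b : Euc 2} {z : Fin m → Euc 2}
    (h : IsOrderedConvex (config a b z)) (i : Fin m) : z i 0 ∈ Set.Icc (a 0) (b 0) := by
  have h₁ := h.1 (show (0 : Fin (m + 2)) <
    (0 : Fin (m + 2)).succAbove ((Fin.last m).succAbove i) by simp [Fin.lt_def])
  have h₂ := h.1 (show (0 : Fin (m + 2)).succAbove ((Fin.last m).succAbove i) <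
    (0 : Fin (m + 2)).succAbove (Fin.last m) by simp [Fin.lt_def])
  simp only [config_zero, config_last, config_mid] at h₁ h₂
  exact ⟨h₁.le, h₂.le⟩

theorem measurable_config :
    Measurable fun q : (Euc 2 × Euc 2) × (Fin m → Euc 2) => config q.1.1 q.1.2 q.2 := by
  rw [measurable_pi_iff, forall_config]
  simp only [config_zero, config_last, config_mid]
  refine ⟨by fun_prop, by fun_prop, fun i => by fun_prop⟩

end config

theorem lintegral_pi_config {m : ℕ} (μ : Measure (Euc 2)) [SigmaFinite μ]
    {F : (Fin (m + 2) → Euc 2) → ENNReal} (hF : Measurable F) :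
    ∫⁻ y, F y ∂(Measure.pi fun _ => μ) =
      ∫⁻ p, ∫⁻ z, F (config p.1 p.2 z) ∂(Measure.pi fun _ => μ) ∂(μ.prod μ) := by
  have h₁ := (measurePreserving_piFinSuccAbove (fun _ : Fin (m + 2) => μ) 0).symm
  have h₂ := (measurePreserving_piFinSuccAbove (fun _ : Fin (m + 1) => μ) (Fin.last m)).symm
  have hG : Measurable fun q : (Euc 2 × Euc 2) × (Fin m → Euc 2) =>
      F (config q.1.1 q.1.2 q.2) := hF.comp measurable_config
  have hF₁ : Measurable fun q => F ((MeasurableEquiv.piFinSuccAbove (fun _ => Euc 2) 0).symm q) :=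
    hF.comp h₁.measurable
  rw [← h₁.lintegral_comp hF, lintegral_prod _ hF₁.aemeasurable,
    lintegral_prod _ hG.lintegral_prod_right'.aemeasurable]
  refine lintegral_congr fun a => ?_
  have hFa : Measurable fun q =>
      F ((MeasurableEquiv.piFinSuccAbove (fun _ => Euc 2) 0).symm (a, q)) :=
    hF₁.comp measurable_prodMk_left
  have hF₂ : Measurable fun q => F ((MeasurableEquiv.piFinSuccAbove (fun _ => Euc 2) 0).symm
      (a, (MeasurableEquiv.piFinSuccAbove (fun _ => Euc 2) (Fin.last m)).symm q)) :=
    hFa.comp h₂.measurable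
  rw [← h₂.lintegral_comp hFa, lintegral_prod _ hF₂.aemeasurable]
  rfl

/-- The area of the convex hull of the points `w` together with `(0, 0)` and `(1, 0)`. -/
noncomputable def chordArea {m : ℕ} (w : Fin m → Euc 2) : ENNReal :=
  volume (hullInterior (config 0 unitX w))

/-- The normalized configurations that are in convex position, ordered from left to right. -/
def chordSet (m : ℕ) : Set (Fin m → Euc 2) := {w | IsOrderedConvex (config 0 unitX w)}

theorem measurable_measure_hullInterior {k : ℕ} (μ : Measure (Euc 2)) [SFinite μ] :
    Measurable fun y : Fin k → Euc 2 => μ (hullInterior y) :=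
  measurable_measure_prodMk_left (measurableSet_setOf_mem_hullInterior (Fin k))

theorem measurable_chord_config (m : ℕ) :
    Measurable fun w : Fin m → Euc 2 => config 0 unitX w :=
  measurable_config.comp (measurable_prodMk_left (x := ((0 : Euc 2), unitX)))

theorem measurable_chordArea (m : ℕ) : Measurable (chordArea (m := m)) :=
  (measurable_measure_hullInterior volume).comp (measurable_chord_config m)

theorem measurableSet_chordSet (m : ℕ) : MeasurableSet (chordSet m) :=
  measurable_chord_config m (measurableSet_isOrderedConvex (m + 2))

theorem chordArea_ne_top {m : ℕ} (w : Fin m → Euc 2) : chordArea w ≠ ⊤ := by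
  refine ne_top_of_le_ne_top ?_ (measure_mono interior_subset)
  exact ((Set.finite_range _).isCompact_convexHull ℝ).measure_lt_top.ne

theorem exists_le_chordArea (m : ℕ) :
    ∃ τ : ℝ, 0 < τ ∧ ∀ (w : Fin m → Euc 2) (i : Fin m), τ * |w i 1| ≤ (chordArea w).toReal := by
  let t : Fin 3 → Euc 2 := ![0, unitX, !₂[0, 1]]
  have hint : (hullInterior t).Nonempty := by
    rw [hullInterior, interior_convexHull_nonempty_iff_affineSpan_eq_top]
    have h0 : (0 : Euc 2) ∈ Set.range t := ⟨0, rfl⟩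
    rw [← AffineSubspace.direction_eq_top_iff_of_nonempty ⟨_, subset_affineSpan ℝ _ h0⟩,
      direction_affineSpan, vectorSpan_eq_span_vsub_set_right ℝ h0, eq_top_iff]
    rintro p -
    have hp : p = p 0 • unitX + p 1 • (!₂[0, 1] : Euc 2) := by
      ext i; fin_cases i <;> simp [unitX]
    rw [hp]
    refine Submodule.add_mem _ (Submodule.smul_mem _ _ (Submodule.subset_span ?_))
      (Submodule.smul_mem _ _ (Submodule.subset_span ?_))
    · exact ⟨t 1, ⟨1, rfl⟩, by simp [t]⟩
    · exact ⟨t 2, ⟨2, rfl⟩, by simp [t]⟩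
  have hpos : 0 < volume (hullInterior t) := isOpen_interior.measure_pos volume hint
  have htop : volume (hullInterior t) ≠ ⊤ :=
    ne_top_of_le_ne_top ((Set.finite_range t).isCompact_convexHull ℝ).measure_lt_top.ne
      (measure_mono interior_subset)
  refine ⟨(volume (hullInterior t)).toReal, ENNReal.toReal_pos hpos.ne' htop, fun w i => ?_⟩
  rcases eq_or_ne (w i 1) 0 with h | h
  · simp [h]
  let M : Euc 2 →ₗ[ℝ] Euc 2 :=
    { toFun := fun p => p 0 • unitX + p 1 • w i
      map_add' := fun p q => by simp [add_smul]; abel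
      map_smul' := fun c p => by simp [mul_smul] }
  have hdet : LinearMap.det M = w i 1 := by
    rw [← LinearMap.det_toMatrix (EuclideanSpace.basisFun (Fin 2) ℝ).toBasis, Matrix.det_fin_two]
    simp [LinearMap.toMatrix_apply, M, unitX]
  let L := LinearMap.equivOfDetNeZero M (by rwa [hdet])
  have hL : (L : Euc 2 →ₗ[ℝ] Euc 2) = M := rfl
  have hLap : ∀ p, L p = p 0 • unitX + p 1 • w i := fun p => rfl
  have hsub : hullInterior (fun j => 0 + L (t j)) ⊆ hullInterior (config 0 unitX w) := by
    refine interior_mono (convexHull_mono ?_)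
    rintro _ ⟨j, rfl⟩
    fin_cases j
    · exact ⟨0, by simp [config_zero, hLap, t]⟩
    · exact ⟨_, (config_last 0 unitX w).trans (by simp [hLap, t, unitX])⟩
    · exact ⟨_, (config_mid 0 unitX w i).trans (by simp [hLap, t])⟩
  have hle := measure_mono (μ := volume) hsub
  rw [hullInterior_affine, volume_image_affine, hL, hdet] at hle
  have := ENNReal.toReal_mono (chordArea_ne_top w) hle
  rw [ENNReal.toReal_mul, ENNReal.toReal_ofReal (abs_nonneg _)] at this
  linarith

theorem integrable_exp_neg_mul_abs {c : ℝ} (hc : 0 < c) :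
    Integrable fun t : ℝ => Real.exp (-(c * |t|)) := by
  rw [← integrableOn_univ, ← Set.Iic_union_Ioi (a := (0 : ℝ)), integrableOn_union]
  constructor
  · refine (integrableOn_exp_mul_Iic hc 0).congr_fun (fun t ht => ?_) measurableSet_Iic
    simp [abs_of_nonpos (Set.mem_Iic.1 ht)]
  · refine (integrableOn_exp_mul_Ioi (neg_lt_zero.2 hc) 0).congr_fun (fun t ht => ?_)
      measurableSet_Ioi
    simp [abs_of_pos (Set.mem_Ioi.1 ht)]

theorem lintegral_exp_neg_chordArea_lt_top (m : ℕ) :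
    ∫⁻ w, (chordSet m).indicator
      (fun w => ENNReal.ofReal (Real.exp (-(chordArea w).toReal / 2))) w < ⊤ := by
  obtain ⟨τ, hτ, hle⟩ := exists_le_chordArea m
  set c : ℝ := τ / (2 * (m + 1)) with hc
  have hc0 : 0 < c := by positivity
  let g : Fin 2 → ℝ → ℝ :=
    ![(Set.Icc 0 1).indicator fun _ => 1, fun t => Real.exp (-(c * |t|))]
  have hg : Integrable fun v : Fin 2 → ℝ => ∏ j, g j (v j) := by
    apply Integrable.fintype_prod
    intro j
    fin_cases j
    · exact (integrable_indicator_iff measurableSet_Icc).2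
        (integrableOn_const (by simp))
    · exact integrable_exp_neg_mul_abs hc0
  have hh : Integrable fun p : Euc 2 => ∏ j, g j (p j) :=
    (PiLp.volume_preserving_ofLp (Fin 2)).integrable_comp_of_integrable hg
  have hprod : Integrable fun w : Fin m → Euc 2 => ∏ i, ∏ j, g j (w i j) :=
    Integrable.fintype_prod (f := fun (_ : Fin m) (p : Euc 2) => ∏ j, g j (p j)) fun _ => hh
  refine lt_of_le_of_lt (lintegral_mono fun w => ?_) hprod.lintegral_lt_top
  by_cases hw : w ∈ chordSet m
  swap
  · simp [hw]
  rw [Set.indicator_of_mem hw]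
  apply ENNReal.ofReal_le_ofReal
  have hIcc : ∀ i, w i 0 ∈ Set.Icc (0 : ℝ) 1 := fun i => by
    simpa [unitX] using IsOrderedConvex.config_mem_Icc hw i
  have hval : ∏ i, ∏ j, g j (w i j) = Real.exp (∑ i, -(c * |w i 1|)) := by
    rw [Real.exp_sum]
    refine Finset.prod_congr rfl fun i _ => ?_
    rw [Fin.prod_univ_two]
    simp only [g, Matrix.cons_val_zero, Matrix.cons_val_one, Set.indicator_of_mem (hIcc i), one_mul]
  rw [hval, Real.exp_le_exp, Finset.sum_neg_distrib, neg_div, neg_le_neg_iff]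
  calc ∑ i, c * |w i 1| ≤ ∑ _i : Fin m, (chordArea w).toReal / (2 * (m + 1)) := by
        refine Finset.sum_le_sum fun i _ => ?_
        rw [hc, div_mul_eq_mul_div]
        gcongr
        exact hle w i
    _ = (chordArea w).toReal / 2 * (m / (m + 1)) := by
        simp
        field_simp
    _ ≤ (chordArea w).toReal / 2 * 1 := by
        gcongr
        rw [div_le_one (by positivity)]
        linarith
    _ = _ := mul_one _

theorem one_sub_div_pow_le {v : ENNReal} (hv : v ≠ ⊤) {k n : ℕ} (hn : 0 < n) (hkn : 2 * k ≤ n) :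
    (1 - v / n) ^ (n - k) ≤ ENNReal.ofReal (Real.exp (-v.toReal / 2)) := by
  have hn0 : (0 : ℝ) < n := by exact_mod_cast hn
  have h1 : 1 - v / n = ENNReal.ofReal (1 - v.toReal / n) := by
    rw [ENNReal.ofReal_sub _ (by positivity), ENNReal.ofReal_div_of_pos hn0, ENNReal.ofReal_toReal hv]
    simp
  calc (1 - v / n) ^ (n - k) ≤ ENNReal.ofReal (Real.exp (-(v.toReal / n))) ^ (n - k) := by
        rw [h1]
        gcongr
        linarith [Real.add_one_le_exp (-(v.toReal / n))]
    _ = ENNReal.ofReal (Real.exp ((n - k : ℕ) * (-(v.toReal / n)))) := by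
        rw [← ENNReal.ofReal_pow (Real.exp_nonneg _), Real.exp_nat_mul]
    _ ≤ _ := by
        apply ENNReal.ofReal_le_ofReal
        rw [Real.exp_le_exp, Nat.cast_sub (by omega)]
        have hk : (2 : ℝ) * k ≤ n := by exact_mod_cast hkn
        have hv0 : 0 ≤ v.toReal := ENNReal.toReal_nonneg
        have : ((n : ℝ) - k) * -(v.toReal / n) = -(v.toReal * ((n - k) / n)) := by ring
        rw [this, neg_div, neg_le_neg_iff, div_eq_mul_inv]
        gcongr
        rw [le_div_iff₀ hn0]
        linarith

theorem tendsto_one_sub_div_pow {v : ENNReal} (hv : v ≠ ⊤) (k : ℕ) :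
    Tendsto (fun n : ℕ => (1 - v / n) ^ (n - k)) atTop
      (nhds (ENNReal.ofReal (Real.exp (-v.toReal)))) := by
  have hdiv : Tendsto (fun n : ℕ => 1 + -v.toReal / n) atTop (nhds (1 + 0)) :=
    tendsto_const_nhds.add (tendsto_const_div_atTop_nhds_zero_nat _)
  rw [add_zero] at hdiv
  have hreal : Tendsto (fun n : ℕ => (1 + -v.toReal / n) ^ n / (1 + -v.toReal / n) ^ k) atTop
      (nhds (Real.exp (-v.toReal))) := by
    have := (Real.tendsto_one_add_div_pow_exp (-v.toReal)).div (hdiv.pow k) (by simp)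
    rw [one_pow, div_one] at this
    exact this
  refine (ENNReal.tendsto_ofReal hreal).congr' ?_
  filter_upwards [hdiv.eventually (lt_mem_nhds one_pos), eventually_gt_atTop 0,
    eventually_ge_atTop k] with n hpos hn hkn
  have hn0 : (0 : ℝ) < n := by exact_mod_cast hn
  rw [← pow_sub₀ _ hpos.ne' hkn |>.trans (div_eq_mul_inv _ _).symm,
    ENNReal.ofReal_pow hpos.le, neg_div, ← sub_eq_add_neg,
    ENNReal.ofReal_sub _ (by positivity), ENNReal.ofReal_div_of_pos hn0, ENNReal.ofReal_toReal hv]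
  simp

/-- The density, at the tuple `y`, of the event that `y` spans a hole avoiding `n - k` further
random points. -/
noncomputable def holeDensity {k : ℕ} (K : Set (Euc 2)) (n : ℕ) (y : Fin k → Euc 2) : ENNReal :=
  {y | IsOrderedConvex y}.indicator
    (fun y => (volume.restrict K) (hullInterior y)ᶜ ^ (n - k)) y

theorem measurable_holeDensity {k : ℕ} (K : Set (Euc 2)) (n : ℕ) :
    Measurable (holeDensity (k := k) K n) := by
  refine Measurable.indicator (Measurable.pow_const ?_ _) (measurableSet_isOrderedConvex k)
  exact measurable_measure_prodMk_left (measurableSet_setOf_mem_hullInterior (Fin k)).compl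

theorem holeDensity_of_mem {k n : ℕ} {K : Set (Euc 2)} (hc : Convex ℝ K) (hK : volume K = 1)
    {y : Fin k → Euc 2} (hy : IsOrderedConvex y) (hyK : ∀ i, y i ∈ K) :
    holeDensity K n y = (1 - volume (hullInterior y)) ^ (n - k) := by
  have : IsProbabilityMeasure (volume.restrict K) := ⟨by simpa using hK⟩
  have hsub : hullInterior y ⊆ K :=
    interior_subset.trans (convexHull_min (Set.range_subset_iff.2 hyK) hc)
  have hmeas : MeasurableSet (hullInterior y) := isOpen_interior.measurableSet
  rw [holeDensity, Set.indicator_of_mem (by exact hy), prob_compl_eq_one_sub hmeas,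
    Measure.restrict_apply hmeas, Set.inter_eq_left.2 hsub]

theorem holeDensity_of_not {k n : ℕ} {K : Set (Euc 2)} {y : Fin k → Euc 2}
    (hy : ¬ IsOrderedConvex y) : holeDensity K n y = 0 :=
  Set.indicator_of_notMem (s := {y | IsOrderedConvex y}) hy _

/-- The rescaled integral over the interior points of a hole with extreme points `a` and `b`. -/
noncomputable def chordIntegral (m : ℕ) (K : Set (Euc 2)) (n : ℕ) (p : Euc 2 × Euc 2) : ENNReal :=
  n ^ m * ∫⁻ z : Fin m → Euc 2, holeDensity K n (config p.1 p.2 z)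
    ∂(Measure.pi fun _ => volume.restrict K)

theorem measurable_chordIntegral (m : ℕ) (K : Set (Euc 2)) (n : ℕ) :
    Measurable (chordIntegral m K n) := by
  have h : Measurable fun q : (Euc 2 × Euc 2) × (Fin m → Euc 2) =>
      holeDensity K n (config q.1.1 q.1.2 q.2) := (measurable_holeDensity K n).comp measurable_config
  exact h.lintegral_prod_right'.const_mul _

theorem chordIntegral_of_not_lt {m n : ℕ} {K : Set (Euc 2)} {p : Euc 2 × Euc 2}
    (hp : ¬ p.1 0 < p.2 0) : chordIntegral m K n p = 0 := by
  have h : ∀ z : Fin m → Euc 2, holeDensity K n (config p.1 p.2 z) = 0 := fun z =>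
    holeDensity_of_not fun hz => hp hz.config_lt
  simp [chordIntegral, h]

theorem chordIntegral_eq {m n : ℕ} {K : Set (Euc 2)} (hc : Convex ℝ K) (hm : MeasurableSet K)
    (hK : volume K = 1) {p : Euc 2 × Euc 2} (h₁ : p.1 ∈ K) (h₂ : p.2 ∈ K)
    (hv : (p.2 - p.1) 0 ≠ 0) (hpos : 0 < (p.2 - p.1) 0) (hn : ((n : ℝ)⁻¹) ≠ 0) :
    chordIntegral m K n p =
      ∫⁻ w, (chordSet m ∩ {w | ∀ i, p.1 + shearEquiv (p.2 - p.1) (n : ℝ)⁻¹ hv hn (w i) ∈ K}).indicator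
        (fun w => (1 - chordArea w / n) ^ (n - (m + 2))) w := by
  set L := shearEquiv (p.2 - p.1) (n : ℝ)⁻¹ hv hn with hL
  have hdet : LinearMap.det (L : Euc 2 →ₗ[ℝ] Euc 2) = (n : ℝ)⁻¹ := by
    rw [hL, coe_shearEquiv, det_shearMap hv]
  let g : (Fin m → Euc 2) → ENNReal :=
    (Set.univ.pi fun _ => K).indicator fun z => holeDensity K n (config p.1 p.2 z)
  have hpiK : MeasurableSet (Set.univ.pi fun _ : Fin m => K) := MeasurableSet.univ_pi fun _ => hm
  have hg : Measurable g := ((measurable_holeDensity K n).comp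
    (measurable_config.comp (measurable_prodMk_left (x := p)))).indicator hpiK
  have hcv := lintegral_pi_affine m L p.1 hg
  have hnn : (0 : ℝ) ≤ n := n.cast_nonneg
  rw [hdet, inv_inv, abs_of_nonneg hnn, ENNReal.ofReal_natCast] at hcv
  rw [chordIntegral, ← Measure.restrict_pi_pi (fun _ : Fin m => (volume : Measure (Euc 2))) fun _ => K,
    ← lintegral_indicator hpiK]
  refine hcv.symm.trans (lintegral_congr fun w => ?_)
  have hconf : config p.1 p.2 (fun i => p.1 + L (w i)) =
      fun i => p.1 + L (config 0 unitX w i) := by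
    rw [← comp_config 0 unitX w fun q => p.1 + L q, hL, shearEquiv_unitX]
    simp
  have hord : IsOrderedConvex (config p.1 p.2 fun i => p.1 + L (w i)) ↔ w ∈ chordSet m := by
    rw [hconf, isOrderedConvex_affine_iff L p.1 hpos (fun q => by simp [hL, shearEquiv_apply])]
    rfl
  have hvol : volume (hullInterior (config p.1 p.2 fun i => p.1 + L (w i))) = chordArea w / n := by
    have hn0 : 0 < (n : ℝ) := lt_of_le_of_ne hnn fun h => hn (by simp [← h])
    rw [hconf, hullInterior_affine, volume_image_affine, hdet, abs_of_nonneg (by positivity),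
      ENNReal.ofReal_inv_of_pos hn0, ENNReal.ofReal_natCast, mul_comm, ← div_eq_mul_inv]
    rfl
  by_cases hwK : ∀ i, p.1 + L (w i) ∈ K
  · have hmem : (fun i => p.1 + L (w i)) ∈ Set.univ.pi fun _ : Fin m => K := fun i _ => hwK i
    simp only [g]
    rw [Set.indicator_of_mem hmem]
    by_cases hw : w ∈ chordSet m
    · have hall : ∀ i, config p.1 p.2 (fun i => p.1 + L (w i)) i ∈ K := by
        rw [forall_config]
        simp only [config_zero, config_last, config_mid]
        exact ⟨h₁, h₂, hwK⟩
      rw [Set.indicator_of_mem (by exact ⟨hw, hwK⟩), holeDensity_of_mem hc hK (hord.2 hw) hall, hvol]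
    · rw [Set.indicator_of_notMem fun h => hw h.1, holeDensity_of_not fun h => hw (hord.1 h)]
  · have hmem : (fun i => p.1 + L (w i)) ∉ Set.univ.pi fun _ : Fin m => K :=
      fun h => hwK fun i => h i (Set.mem_univ i)
    simp only [g]
    rw [Set.indicator_of_notMem hmem, Set.indicator_of_notMem fun h => hwK h.2]

/-- The limit of the rescaled chord integrals, which depends on the number of points only. -/
noncomputable def chordLimit (m : ℕ) : ENNReal :=
  ∫⁻ w, (chordSet m).indicator (fun w => ENNReal.ofReal (Real.exp (-(chordArea w).toReal))) w

/-- A uniform bound for the rescaled chord integrals. -/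
noncomputable def chordBound (m : ℕ) : ENNReal :=
  ∫⁻ w, (chordSet m).indicator
    (fun w => ENNReal.ofReal (Real.exp (-(chordArea w).toReal / 2))) w

theorem chordLimit_ne_top (m : ℕ) : chordLimit m ≠ ⊤ := by
  refine ne_top_of_le_ne_top (lintegral_exp_neg_chordArea_lt_top m).ne (lintegral_mono fun w => ?_)
  refine Set.indicator_le_indicator (ENNReal.ofReal_le_ofReal (Real.exp_le_exp.2 ?_))
  linarith [(ENNReal.toReal_nonneg : 0 ≤ (chordArea w).toReal)]

theorem indicator_chord_le {m n : ℕ} (hn : 0 < n) (hmn : 2 * (m + 2) ≤ n)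
    (s : Set (Fin m → Euc 2)) (w : Fin m → Euc 2) :
    (chordSet m ∩ s).indicator (fun w => (1 - chordArea w / n) ^ (n - (m + 2))) w ≤
      (chordSet m).indicator
        (fun w => ENNReal.ofReal (Real.exp (-(chordArea w).toReal / 2))) w :=
  (Set.indicator_le_indicator_of_subset Set.inter_subset_left (fun _ => zero_le) w).trans
    (Set.indicator_le_indicator (one_sub_div_pow_le (chordArea_ne_top w) hn hmn))

theorem chordIntegral_le {m n : ℕ} {K : Set (Euc 2)} (hc : Convex ℝ K) (hm : MeasurableSet K)
    (hK : volume K = 1) {p : Euc 2 × Euc 2} (h₁ : p.1 ∈ K) (h₂ : p.2 ∈ K)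
    (hmn : 2 * (m + 2) ≤ n) : chordIntegral m K n p ≤ chordBound m := by
  by_cases hp : p.1 0 < p.2 0
  · have hpos : 0 < (p.2 - p.1) 0 := by simpa using hp
    have hn0 : 0 < n := by omega
    have hn : ((n : ℝ)⁻¹) ≠ 0 := by positivity
    rw [chordIntegral_eq hc hm hK h₁ h₂ hpos.ne' hpos hn]
    exact lintegral_mono fun w => indicator_chord_le hn0 hmn _ w
  · simp [chordIntegral_of_not_lt hp]

theorem eventually_shear_mem {K : Set (Euc 2)} (hc : Convex ℝ K) {p : Euc 2 × Euc 2}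
    (h₁ : p.1 ∈ interior K) (h₂ : p.2 ∈ interior K) {q : Euc 2} (hq : q 0 ∈ Set.Icc (0 : ℝ) 1) :
    ∀ᶠ n : ℕ in atTop, p.1 + shearMap (p.2 - p.1) (n : ℝ)⁻¹ q ∈ K := by
  set v := p.2 - p.1 with hv
  have hlim : Tendsto (fun n : ℕ => p.1 + shearMap v (n : ℝ)⁻¹ q) atTop
      (nhds (p.1 + q 0 • v)) := by
    have heq : ∀ n : ℕ, p.1 + shearMap v (n : ℝ)⁻¹ q =
        p.1 + q 0 • v + ((n : ℝ)⁻¹) • (!₂[0, q 1 / v 0] : Euc 2) := by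
      intro n
      ext i
      fin_cases i <;> simp [shearMap] <;> ring
    simp only [heq]
    have h0 : Tendsto (fun n : ℕ => ((n : ℝ)⁻¹) • (!₂[0, q 1 / v 0] : Euc 2)) atTop
        (nhds ((0 : ℝ) • (!₂[0, q 1 / v 0] : Euc 2))) :=
      tendsto_inv_atTop_nhds_zero_nat.smul_const _
    have := (tendsto_const_nhds (x := p.1 + q 0 • v)).add h0
    rwa [zero_smul, add_zero] at this
  have hmem : p.1 + q 0 • v ∈ interior K := by
    have := hc.interior h₁ h₂ (sub_nonneg.2 hq.2) hq.1 (by ring)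
    convert this using 1
    rw [hv]
    module
  filter_upwards [hlim.eventually (isOpen_interior.mem_nhds hmem)] with n hn
  exact interior_subset hn

theorem tendsto_chordIntegral {m : ℕ} {K : Set (Euc 2)} (hc : Convex ℝ K) (hm : MeasurableSet K)
    (hK : volume K = 1) {p : Euc 2 × Euc 2} (h₁ : p.1 ∈ interior K) (h₂ : p.2 ∈ interior K)
    (hp : p.1 0 < p.2 0) :
    Tendsto (fun n => chordIntegral m K n p) atTop (nhds (chordLimit m)) := by
  have hpos : 0 < (p.2 - p.1) 0 := by simpa using hp
  have hev : (fun n => chordIntegral m K n p) =ᶠ[atTop] fun n : ℕ => ∫⁻ w,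
      (chordSet m ∩ {w | ∀ i, p.1 + shearMap (p.2 - p.1) (n : ℝ)⁻¹ (w i) ∈ K}).indicator
        (fun w => (1 - chordArea w / n) ^ (n - (m + 2))) w := by
    filter_upwards [eventually_gt_atTop 0] with n hn0
    have hn : ((n : ℝ)⁻¹) ≠ 0 := by positivity
    exact chordIntegral_eq hc hm hK (interior_subset h₁) (interior_subset h₂) hpos.ne' hpos hn
  refine Tendsto.congr' hev.symm ?_
  refine tendsto_lintegral_filter_of_dominated_convergence
    ((chordSet m).indicator fun w => ENNReal.ofReal (Real.exp (-(chordArea w).toReal / 2)))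
    ?_ ?_ (lintegral_exp_neg_chordArea_lt_top m).ne (Eventually.of_forall fun w => ?_)
  · refine Eventually.of_forall fun n => ?_
    refine Measurable.indicator ?_ ((measurableSet_chordSet m).inter ?_)
    · exact (measurable_const.sub ((measurable_chordArea m).div_const _)).pow_const _
    · simp only [Set.ofPred_forall]
      refine MeasurableSet.iInter fun i => ?_
      have : Continuous (shearMap (p.2 - p.1) (n : ℝ)⁻¹) := LinearMap.continuous_of_finiteDimensional _
      have hmeas : Measurable fun w : Fin m → Euc 2 =>
          p.1 + shearMap (p.2 - p.1) (n : ℝ)⁻¹ (w i) :=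
        measurable_const.add (this.measurable.comp (measurable_pi_apply i))
      exact hmeas hm
  · filter_upwards [eventually_ge_atTop (2 * (m + 2))] with n hn
    exact Eventually.of_forall fun w => indicator_chord_le (by omega) hn _ w
  · by_cases hw : w ∈ chordSet m
    · have hIcc : ∀ i, w i 0 ∈ Set.Icc (0 : ℝ) 1 := fun i => by
        simpa [unitX] using IsOrderedConvex.config_mem_Icc hw i
      rw [Set.indicator_of_mem hw]
      refine (tendsto_one_sub_div_pow (chordArea_ne_top w) (m + 2)).congr' ?_
      filter_upwards [eventually_all.2 fun i => eventually_shear_mem hc h₁ h₂ (hIcc i)] with n hn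
      rw [Set.indicator_of_mem (by exact ⟨hw, hn⟩)]
    · rw [Set.indicator_of_notMem hw]
      refine tendsto_const_nhds.congr fun n => ?_
      rw [Set.indicator_of_notMem fun h => hw h.1]

theorem ae_prod_mem_interior {K : Set (Euc 2)} (hc : Convex ℝ K) (hm : MeasurableSet K) :
    ∀ᵐ p ∂((volume.restrict K).prod (volume.restrict K)), p.1 ∈ interior K ∧ p.2 ∈ interior K := by
  have h : ∀ᵐ a ∂(volume.restrict K), a ∈ interior K := by
    rw [ae_restrict_iff' hm]
    have : ∀ᵐ a, a ∉ frontier K := measure_eq_zero_iff_ae_notMem.1 (hc.addHaar_frontier volume)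
    filter_upwards [this] with a ha haK
    by_contra hi
    exact ha ⟨subset_closure haK, hi⟩
  exact (Measure.quasiMeasurePreserving_fst.ae h).and (Measure.quasiMeasurePreserving_snd.ae h)

theorem measure_prod_fst_lt_snd {K : Set (Euc 2)} (hK : volume K = 1) :
    ((volume.restrict K).prod (volume.restrict K)) {p : Euc 2 × Euc 2 | p.1 0 < p.2 0} = 2⁻¹ := by
  have : IsProbabilityMeasure (volume.restrict K) := ⟨by simpa using hK⟩
  set ν := (volume.restrict K).prod (volume.restrict K) with hν
  have hlt : MeasurableSet {p : Euc 2 × Euc 2 | p.1 0 < p.2 0} :=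
    measurableSet_lt (by fun_prop) (by fun_prop)
  have hgt : MeasurableSet {p : Euc 2 × Euc 2 | p.2 0 < p.1 0} :=
    measurableSet_lt (by fun_prop) (by fun_prop)
  have hswap : ν {p : Euc 2 × Euc 2 | p.2 0 < p.1 0} = ν {p : Euc 2 × Euc 2 | p.1 0 < p.2 0} :=
    (Measure.measurePreserving_swap (μ := volume.restrict K)
      (ν := volume.restrict K)).measure_preimage hlt.nullMeasurableSet
  have hne : ∀ᵐ p ∂ν, p.1 0 ≠ p.2 0 := by
    have hmp := measurePreserving_piFinTwo fun _ : Fin 2 => (volume : Measure (Euc 2)).restrict K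
    have hmeas : MeasurableSet {p : Euc 2 × Euc 2 | p.1 0 ≠ p.2 0} :=
      (measurableSet_eq_fun (f := fun p : Euc 2 × Euc 2 => p.1 0) (g := fun p => p.2 0)
        (by fun_prop) (by fun_prop)).compl
    rw [hν, ← hmp.map_eq, ae_map_iff hmp.measurable.aemeasurable hmeas]
    filter_upwards [ae_injective_fst_coord 2 K] with x hx h
    exact absurd (hx h) (by decide)
  have hunion : ν ({p : Euc 2 × Euc 2 | p.1 0 < p.2 0} ∪ {p | p.2 0 < p.1 0}) = 1 := by
    rw [← mem_ae_iff_prob_eq_one (hlt.union hgt)]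
    filter_upwards [hne] with p hp
    exact lt_or_gt_of_ne hp
  rw [measure_union _ hgt, hswap, ← two_mul] at hunion
  · exact ENNReal.eq_inv_of_mul_eq_one_left (by rwa [mul_comm])
  · exact Set.disjoint_left.2 fun p hp hp' => lt_asymm (Set.mem_ofPred.1 hp) (Set.mem_ofPred.1 hp')

theorem tendsto_lintegral_chordIntegral (m : ℕ) {K : Set (Euc 2)} (hc : Convex ℝ K)
    (hm : MeasurableSet K) (hK : volume K = 1) :
    Tendsto (fun n => ∫⁻ p, chordIntegral m K n p ∂((volume.restrict K).prod (volume.restrict K)))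
      atTop (nhds (chordLimit m * 2⁻¹)) := by
  have : IsProbabilityMeasure (volume.restrict K) := ⟨by simpa using hK⟩
  have hlt : MeasurableSet {p : Euc 2 × Euc 2 | p.1 0 < p.2 0} :=
    measurableSet_lt (by fun_prop) (by fun_prop)
  rw [← measure_prod_fst_lt_snd hK, ← lintegral_indicator_const hlt]
  refine tendsto_lintegral_filter_of_dominated_convergence (fun _ => chordBound m)
    (Eventually.of_forall fun n => measurable_chordIntegral m K n) ?_ ?_ ?_
  · filter_upwards [eventually_ge_atTop (2 * (m + 2))] with n hn
    filter_upwards [ae_prod_mem_interior hc hm] with p hp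
    exact chordIntegral_le hc hm hK (interior_subset hp.1) (interior_subset hp.2) hn
  · rw [lintegral_const, measure_univ, mul_one]
    exact (lintegral_exp_neg_chordArea_lt_top m).ne
  · filter_upwards [ae_prod_mem_interior hc hm] with p hp
    by_cases h : p.1 0 < p.2 0
    · rw [Set.indicator_of_mem (by exact h)]
      exact tendsto_chordIntegral hc hm hK hp.1 hp.2 h
    · rw [Set.indicator_of_notMem (by exact h)]
      simp only [chordIntegral_of_not_lt h]
      exact tendsto_const_nhds

theorem EH_div_sq_eq {m n : ℕ} {K : Set (Euc 2)} (hK : volume K = 1) (hn : 0 < n) :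
    EH 2 (m + 2) K n / (n : ℝ) ^ 2 = (n.descFactorial (m + 2) / (n : ℝ) ^ (m + 2)) *
      (∫⁻ p, chordIntegral m K n p ∂((volume.restrict K).prod (volume.restrict K))).toReal := by
  have : IsProbabilityMeasure (volume.restrict K) := ⟨by simpa using hK⟩
  have h := lintegral_pi_config (volume.restrict K) (measurable_holeDensity (k := m + 2) K n)
  have hmeas : Measurable fun q : (Euc 2 × Euc 2) × (Fin m → Euc 2) =>
      holeDensity K n (config q.1.1 q.1.2 q.2) := (measurable_holeDensity K n).comp measurable_config
  simp only [chordIntegral]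
  rw [EH_eq hK, lintegral_const_mul _ hmeas.lintegral_prod_right', ← h, ENNReal.toReal_mul,
    ENNReal.toReal_pow, ENNReal.toReal_natCast]
  have hn0 : (n : ℝ) ≠ 0 := by positivity
  simp only [holeDensity]
  field_simp
  ring

theorem tendsto_descFactorial_div_pow (k : ℕ) :
    Tendsto (fun n : ℕ => (n.descFactorial k : ℝ) / (n : ℝ) ^ k) atTop (nhds 1) := by
  refine (Asymptotics.isEquivalent_iff_tendsto_one ?_).1 (isEquivalent_descFactorial k)
  filter_upwards [eventually_gt_atTop 0] with n hn
  positivity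

/-- For every `k ≥ 3` there is a constant `C = C(k)` such that for every convex
body `K ⊆ ℝ²` of unit area, `n^{-2} EH^K_{2,k}(n) → C` as `n → ∞`. -/
theorem statement8 (k : ℕ) (hk : 3 ≤ k) :
    ∃ C : ℝ, ∀ K : Set (Euc 2), IsConvexBody K → volume K = 1 →
      Filter.Tendsto (fun n : ℕ => EH 2 k K n / (n : ℝ) ^ 2) Filter.atTop
        (nhds C) := by
  obtain ⟨m, rfl⟩ : ∃ m, k = m + 2 := ⟨k - 2, by omega⟩
  refine ⟨(chordLimit m * 2⁻¹).toReal, fun K hKb hK => ?_⟩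
  have hne : chordLimit m * 2⁻¹ ≠ ⊤ := ENNReal.mul_ne_top (chordLimit_ne_top m) (by simp)
  have hlim := (tendsto_descFactorial_div_pow (m + 2)).mul ((ENNReal.tendsto_toReal hne).comp
    (tendsto_lintegral_chordIntegral m hKb.1 hKb.2.1.measurableSet hK))
  rw [one_mul] at hlim
  refine hlim.congr' ?_
  filter_upwards [eventually_gt_atTop 0] with n hn
  exact (EH_div_sq_eq hK hn).symm
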